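/- There are no real numbers π₁, π₂, π₃ > 0 simultaneously satisfying the three inequalities (π₂ + π₃)(π₁² + π₂π₃) ≤ π₁(π₂ − π₃)², (π₂ + 1)(π₁² + π₂) ≤ π₁(π₂ − 1)², and (π₃ + 1)(π₁² + π₃) ≤ π₁(π₃ − 1)². -/

import Mathlib

/-- If `x` and `y` lie on the same side of `p`, then the reverse strict inequality holds. -/
theorem mul_sq_sub_lt_of_same_side {p x y : ℝ} (hp : 0 < p) (hx : 0 < x) (hy : 0 < y)
    (h : (p ≤ x ∧ p ≤ y) ∨ (x ≤ p ∧ y ≤ p)) :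
    p * (x - y) ^ 2 < (x + y) * (p ^ 2 + x * y) := by
  wlog hxy : x ≤ y generalizing x y
  · have := this hy hx (by tauto) (le_of_not_ge hxy)
    linarith
  have hsum : y - x < x + y := by linarith
  have hprod : p * (y - x) < p ^ 2 + x * y := by
    have hpx := mul_pos hp hx
    have hxy' := mul_pos hx hy
    rcases h with ⟨h, -⟩ | ⟨-, h⟩ <;> nlinarith
  calc p * (x - y) ^ 2 = (y - x) * (p * (y - x)) := by ring
    _ ≤ (y - x) * (p ^ 2 + x * y) :=
      mul_le_mul_of_nonneg_left hprod.le (sub_nonneg.2 hxy)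
    _ < (x + y) * (p ^ 2 + x * y) := mul_lt_mul_of_pos_right hsum (by positivity)

/-- The polynomial inequality system arising from the D-optimality conditions of the claw
design in the Bradley–Terry model with four alternatives is infeasible: there are no
positive reals `π₁, π₂, π₃` with
`(π₂+π₃)(π₁²+π₂π₃) ≤ π₁(π₂−π₃)²`, `(π₂+1)(π₁²+π₂) ≤ π₁(π₂−1)²` and
`(π₃+1)(π₁²+π₃) ≤ π₁(π₃−1)²`. -/
theorem claw_inequality_system_infeasible :
    ¬ ∃ π₁ π₂ π₃ : ℝ, 0 < π₁ ∧ 0 < π₂ ∧ 0 < π₃ ∧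
      (π₂ + π₃) * (π₁ ^ 2 + π₂ * π₃) ≤ π₁ * (π₂ - π₃) ^ 2 ∧
      (π₂ + 1) * (π₁ ^ 2 + π₂) ≤ π₁ * (π₂ - 1) ^ 2 ∧
      (π₃ + 1) * (π₁ ^ 2 + π₃) ≤ π₁ * (π₃ - 1) ^ 2 := by
  rintro ⟨p, x, y, hp, hx, hy, hxy, hx1, hy1⟩
  have not_same_side_xy := mt (mul_sq_sub_lt_of_same_side hp hx hy) hxy.not_gt
  have not_same_side_x := mt (mul_sq_sub_lt_of_same_side hp hx one_pos) (by simpa using hx1)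
  have not_same_side_y := mt (mul_sq_sub_lt_of_same_side hp hy one_pos) (by simpa using hy1)
  have := le_total p x
  have := le_total p y
  have := le_total p 1
  tauto
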